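/- arXiv:2106.01190 — 2 statements merged into one kernel-verified Lean document; each statement's English description precedes it below -/
import Mathlib

section
/- Let σ and n be positive integers with σ < n, and write n = mσ + p with 0 ≤ p < σ. The number of strings of length n over a totally ordered alphabet of size σ whose total number of occurrences of Lyndon subsequences equals the maximum value 2^n − (p + σ)·2^m + n + σ − 1 is exactly the binomial coefficient C(σ, p). -/
/-- A nonempty string is a Lyndon word if it is lexicographically strictly smaller
than all of its nonempty proper suffixes. -/
def IsLyndon {α : Type*} [LinearOrder α] (w : List α) : Prop :=
  w ≠ [] ∧ ∀ i, 0 < i → i < w.length → List.Lex (· < ·) w (w.drop i)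

/-- The subsequence of `w` extracted at the set of positions `S` (taken in increasing order). -/
def subseqAt {α : Type*} (w : List α) (S : Finset (Fin w.length)) : List α :=
  (S.sort (· ≤ ·)).map w.get

/-- The total number of occurrences of Lyndon subsequences in `w`: the number of
(nonempty) sets of positions whose extracted word is a Lyndon word. -/
noncomputable def totalLyndonSubseq {α : Type*} [LinearOrder α] (w : List α) : ℕ :=
  Nat.card {S : Finset (Fin w.length) // IsLyndon (subseqAt w S)}

open Finset

theorem mem_subseqAt {α : Type*} {w : List α} {S : Finset (Fin w.length)} {a : α} :
    a ∈ subseqAt w S ↔ ∃ i ∈ S, w.get i = a := by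
  simp [subseqAt]

theorem length_subseqAt {α : Type*} (w : List α) (S : Finset (Fin w.length)) :
    (subseqAt w S).length = #S := by
  simp [subseqAt]

section LyndonWords

variable {α : Type*} [LinearOrder α]

theorem not_lex_replicate_of_le (c : α) {k l : ℕ} (h : l ≤ k) :
    ¬ List.Lex (· < ·) (List.replicate k c) (List.replicate l c) := by
  induction l generalizing k with
  | zero => simp
  | succ l ih =>
    obtain ⟨k, rfl⟩ : ∃ j, k = j + 1 := ⟨k - 1, by omega⟩
    simp only [List.replicate_succ]
    intro hlex
    cases hlex with
    | rel h => exact lt_irrefl _ h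
    | cons h => exact ih (by omega) h

theorem not_isLyndon_replicate (c : α) {k : ℕ} (hk : k ≠ 1) :
    ¬ IsLyndon (List.replicate k c) := by
  rintro ⟨hne, h⟩
  have hk0 : k ≠ 0 := by rintro rfl; simp at hne
  have := h 1 one_pos (by simp; omega)
  rw [List.drop_replicate] at this
  exact not_lex_replicate_of_le c (by omega) this

theorem lex_drop_of_pairwise_le {a : α} {l : List α} (hs : (a :: l).Pairwise (· ≤ ·))
    (hne : ∃ b ∈ l, b ≠ a) {i : ℕ} (hi : 0 < i) (hil : i < (a :: l).length) :
    List.Lex (· < ·) (a :: l) ((a :: l).drop i) := by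
  induction l generalizing i with
  | nil => simp at hne
  | cons b t ih =>
    have hab : a ≤ b := (List.pairwise_cons.1 hs).1 b (by simp)
    have hbt := (List.pairwise_cons.1 hs).2
    have hbs := (List.pairwise_cons.1 hbt).1
    rw [List.drop_eq_getElem_cons hil]
    have hmem : (a :: b :: t)[i] ∈ b :: t := by
      obtain ⟨j, rfl⟩ : ∃ j, i = j + 1 := ⟨i - 1, by omega⟩
      simp only [List.getElem_cons_succ]
      exact List.getElem_mem _
    have hbi : b ≤ (a :: b :: t)[i] := by
      rcases List.mem_cons.1 hmem with h | h
      · exact h.ge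
      · exact hbs _ h
    rcases (hab.trans hbi).lt_or_eq with hlt | heq
    · exact List.Lex.rel hlt
    · have hba : b = a := le_antisymm (heq ▸ hbi) hab
      subst hba
      rw [← heq]
      refine List.Lex.cons ?_
      rw [List.drop_succ_cons]
      have hne' : ∃ c ∈ t, c ≠ b := by
        obtain ⟨c, hc, hcb⟩ := hne
        exact ⟨c, (List.mem_cons.1 hc).resolve_left hcb, hcb⟩
      refine ih hbt hne' hi ?_
      by_contra hcon
      have hlast : i = t.length + 1 := by simp at hil hcon; omega
      obtain ⟨c, hc, hcb⟩ := hne'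
      obtain ⟨j, hj, rfl⟩ := List.getElem_of_mem hc
      have hle : (b :: b :: t)[j + 2]'(by simp; omega) ≤ (b :: b :: t)[i] := by
        rcases (show j + 2 ≤ i by omega).lt_or_eq with h | h
        · exact List.pairwise_iff_getElem.1 hs _ _ _ _ h
        · simp [h]
      rw [← heq] at hle
      exact hcb (le_antisymm (by simpa using hle) (hbs _ hc))

theorem isLyndon_of_pairwise_le {l : List α} (hs : l.Pairwise (· ≤ ·))
    (hne : ∃ a ∈ l, ∃ b ∈ l, a ≠ b) : IsLyndon l := by
  cases l with
  | nil => simp at hne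
  | cons a l =>
    refine ⟨by simp, fun i hi hil => lex_drop_of_pairwise_le hs ?_ hi hil⟩
    by_contra! hcon
    obtain ⟨x, hx, y, hy, hxy⟩ := hne
    have key : ∀ z ∈ a :: l, z = a := by
      intro z hz
      rcases List.mem_cons.1 hz with h | h
      · exact h
      · exact hcon z h
    exact hxy ((key x hx).trans (key y hy).symm)

theorem isLyndon_singleton (a : α) : IsLyndon [a] :=
  ⟨by simp, fun i hi hil => by simp at hil; omega⟩

theorem pairwise_le_subseqAt {w : List α} (hw : w.Pairwise (· ≤ ·))
    (S : Finset (Fin w.length)) : (subseqAt w S).Pairwise (· ≤ ·) := by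
  rw [subseqAt, List.pairwise_map]
  refine (S.pairwise_sort (· ≤ ·)).imp fun {i j} hij => ?_
  rcases hij.lt_or_eq with h | h
  · exact List.pairwise_iff_get.1 hw _ _ h
  · rw [h]

theorem not_isLyndon_subseqAt_pair {w : List α} {i j : Fin w.length} (hij : i < j)
    (hw : w.get j < w.get i) : ¬ IsLyndon (subseqAt w {i, j}) := by
  have : subseqAt w {i, j} = [w.get i, w.get j] := by
    rw [subseqAt, Finset.sort_insert]
    · simp
    · simpa using hij.le
    · simpa using hij.ne
  rw [this]
  rintro ⟨-, h⟩
  have h1 := h 1 one_pos (by simp)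
  rw [List.drop_succ_cons, List.drop_zero, List.cons_lex_cons_iff] at h1
  rcases h1 with h | ⟨h, -⟩
  · exact lt_asymm h hw
  · exact hw.ne' h

end LyndonWords

section Counting

variable {α : Type*} [LinearOrder α]

open Classical in
/-- The sets of positions of `w` carrying a non-Lyndon word. -/
noncomputable def nonLyndonSets (w : List α) : Finset (Finset (Fin w.length)) :=
  {S | ¬ IsLyndon (subseqAt w S)}

/-- The positions of the letter `c` in `w`. -/
def positions (w : List α) (c : α) : Finset (Fin w.length) := {i | w.get i = c}

theorem mem_positions {w : List α} {c : α} {i : Fin w.length} :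
    i ∈ positions w c ↔ w.get i = c := by
  simp [positions]

theorem card_positions (w : List α) (c : α) : #(positions w c) = w.count c :=
  Fin.card_filter_univ_eq_vector_get_eq_count c ⟨w, rfl⟩

theorem totalLyndonSubseq_add_card_nonLyndonSets (w : List α) :
    totalLyndonSubseq w + #(nonLyndonSets w) = 2 ^ w.length := by
  classical
  rw [totalLyndonSubseq, Nat.card_eq_fintype_card, Fintype.card_subtype, nonLyndonSets,
    Finset.card_filter_add_card_filter_not]
  simp

variable [Fintype α]

/-- The sets of positions of `w` carrying at most one letter. -/
def monochromaticSets (w : List α) : Finset (Finset (Fin w.length)) :=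
  {S | ∃ c, S ⊆ positions w c}

/-- The sets of positions of `w` carrying a power of a letter, the letter itself excluded. -/
def nontrivialMonochromaticSets (w : List α) : Finset (Finset (Fin w.length)) :=
  {S ∈ monochromaticSets w | #S ≠ 1}

theorem card_monochromaticSets [Nonempty α] (w : List α) :
    #(monochromaticSets w) + Fintype.card α = ∑ c : α, 2 ^ w.count c + 1 := by
  have hunion : monochromaticSets w =
      insert ∅ (univ.biUnion fun c => (positions w c).powerset.erase ∅) := by
    ext S
    by_cases hS : S = ∅
    · simp [hS, monochromaticSets]
    · simp [hS, monochromaticSets]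
  have hdisj : ((univ : Finset α) : Set α).PairwiseDisjoint
      fun c => (positions w c).powerset.erase ∅ := by
    intro c _ d _ hcd
    rw [Function.onFun, Finset.disjoint_left]
    intro S hc hd
    simp only [mem_erase, mem_powerset] at hc hd
    obtain ⟨i, hi⟩ := Finset.nonempty_iff_ne_empty.2 hc.1
    exact hcd ((mem_positions.1 (hc.2 hi)).symm.trans (mem_positions.1 (hd.2 hi)))
  rw [hunion, card_insert_of_notMem (by simp), card_biUnion hdisj, Fintype.card_eq_sum_ones,
    add_right_comm, ← sum_add_distrib]
  congr 1
  refine sum_congr rfl fun c _ => ?_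
  rw [card_erase_add_one (by simp), card_powerset, card_positions]

theorem card_nontrivialMonochromaticSets_add_length (w : List α) :
    #(nontrivialMonochromaticSets w) + w.length = #(monochromaticSets w) := by
  have hsing : {S ∈ monochromaticSets w | #S = 1} = powersetCard 1 univ := by
    ext S
    simp only [monochromaticSets, mem_filter, mem_univ, true_and, mem_powersetCard, subset_univ,
      and_iff_right_iff_imp]
    intro h
    obtain ⟨i, rfl⟩ := card_eq_one.1 h
    exact ⟨w.get i, by simp [mem_positions]⟩
  have h := Finset.card_filter_add_card_filter_not (s := monochromaticSets w) (fun S => #S = 1)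
  rw [hsing, card_powersetCard] at h
  simp only [card_univ, Fintype.card_fin, Nat.choose_one_right] at h
  rw [nontrivialMonochromaticSets, ← h, add_comm]

theorem nontrivialMonochromaticSets_subset (w : List α) :
    nontrivialMonochromaticSets w ⊆ nonLyndonSets w := by
  intro S hS
  simp only [nontrivialMonochromaticSets, monochromaticSets, mem_filter, mem_univ,
    true_and] at hS
  obtain ⟨⟨c, hc⟩, hcard⟩ := hS
  simp only [nonLyndonSets, mem_filter, mem_univ, true_and]
  have hrep : subseqAt w S = List.replicate (#S) c := by
    rw [List.eq_replicate_iff]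
    refine ⟨length_subseqAt w S, fun b hb => ?_⟩
    obtain ⟨i, hi, rfl⟩ := mem_subseqAt.1 hb
    exact mem_positions.1 (hc hi)
  rw [hrep]
  exact not_isLyndon_replicate c hcard

theorem nonLyndonSets_eq_iff [Nonempty α] (w : List α) :
    nontrivialMonochromaticSets w = nonLyndonSets w ↔ w.Pairwise (· ≤ ·) := by
  constructor
  · intro h
    rw [List.pairwise_iff_get]
    intro i j hij
    by_contra! hlt
    have hmem : ({i, j} : Finset _) ∈ nontrivialMonochromaticSets w := by
      rw [h]
      simpa [nonLyndonSets] using not_isLyndon_subseqAt_pair hij hlt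
    simp only [nontrivialMonochromaticSets, monochromaticSets, mem_filter, mem_univ,
      true_and] at hmem
    obtain ⟨⟨c, hc⟩, -⟩ := hmem
    have hi := mem_positions.1 (hc (by simp : i ∈ ({i, j} : Finset _)))
    have hj := mem_positions.1 (hc (by simp : j ∈ ({i, j} : Finset _)))
    exact hlt.ne (hj.trans hi.symm)
  · intro hw
    refine (nontrivialMonochromaticSets_subset w).antisymm fun S hS => ?_
    simp only [nonLyndonSets, mem_filter, mem_univ, true_and] at hS
    simp only [nontrivialMonochromaticSets, monochromaticSets, mem_filter, mem_univ, true_and]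
    constructor
    · by_contra! hcon
      refine hS (isLyndon_of_pairwise_le (pairwise_le_subseqAt hw S) ?_)
      have hne : S.Nonempty := by
        rw [nonempty_iff_ne_empty]
        rintro rfl
        exact hcon (Classical.arbitrary α) (by simp)
      obtain ⟨i, hi⟩ := hne
      obtain ⟨j, hj, hji⟩ := Finset.not_subset.1 (hcon (w.get i))
      exact ⟨_, mem_subseqAt.2 ⟨j, hj, rfl⟩, _, mem_subseqAt.2 ⟨i, hi, rfl⟩,
        fun h => hji (mem_positions.2 h)⟩
    · intro hcard
      rw [← length_subseqAt, List.length_eq_one_iff] at hcard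
      obtain ⟨a, ha⟩ := hcard
      exact hS (ha ▸ isLyndon_singleton a)

end Counting

section Balanced

theorem succ_mul_two_pow_le (k m : ℕ) : (k + 1) * 2 ^ m ≤ 2 ^ k + m * 2 ^ m := by
  rcases le_total m k with h | h
  · obtain ⟨d, rfl⟩ := Nat.exists_eq_add_of_le h
    have := Nat.mul_le_mul_left (2 ^ m) (Nat.lt_two_pow_self (n := d))
    rw [pow_add]
    simp only [Nat.succ_eq_add_one] at this
    linarith
  · obtain ⟨d, rfl⟩ := Nat.exists_eq_add_of_le h
    rcases Nat.eq_zero_or_pos d with rfl | hd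
    · simp; linarith
    · have := Nat.mul_le_mul_right (2 ^ (k + d)) (show k + 1 ≤ k + d by omega)
      linarith [Nat.zero_le (2 ^ k)]

theorem succ_mul_two_pow_eq_iff (k m : ℕ) :
    (k + 1) * 2 ^ m = 2 ^ k + m * 2 ^ m ↔ k = m ∨ k = m + 1 := by
  constructor
  · intro heq
    rcases le_total m k with h | h
    · obtain ⟨d, rfl⟩ := Nat.exists_eq_add_of_le h
      have hd : d + 1 = 2 ^ d := by
        refine Nat.eq_of_mul_eq_mul_left (Nat.two_pow_pos m) ?_
        rw [pow_add] at heq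
        linarith
      match d, hd with
      | 0, _ => simp
      | 1, _ => simp
      | d + 2, hd =>
        have := Nat.lt_two_pow_self (n := d)
        rw [pow_add] at hd
        omega
    · obtain ⟨d, rfl⟩ := Nat.exists_eq_add_of_le h
      rcases Nat.eq_zero_or_pos d with rfl | hd
      · simp
      · have := Nat.mul_le_mul_right (2 ^ (k + d)) (show k + 1 ≤ k + d by omega)
        have := Nat.two_pow_pos k
        omega
  · rintro (rfl | rfl) <;> ring

variable {ι : Type*} [Fintype ι]

theorem sum_two_pow_ge_and_eq_iff {m p : ℕ} {k : ι → ℕ}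
    (hk : ∑ c, k c = m * Fintype.card ι + p) :
    (p + Fintype.card ι) * 2 ^ m ≤ ∑ c, 2 ^ k c ∧
      (∑ c, 2 ^ k c = (p + Fintype.card ι) * 2 ^ m ↔ ∀ c, k c = m ∨ k c = m + 1) := by
  have hle : ∀ c ∈ univ, (k c + 1) * 2 ^ m ≤ 2 ^ k c + m * 2 ^ m :=
    fun c _ => succ_mul_two_pow_le _ _
  have hleft : ∑ c, (k c + 1) * 2 ^ m =
      (p + Fintype.card ι) * 2 ^ m + Fintype.card ι * (m * 2 ^ m) := by
    rw [← sum_mul, sum_add_distrib, hk]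
    simp
    ring
  have hright : ∑ c, (2 ^ k c + m * 2 ^ m) =
      ∑ c, 2 ^ k c + Fintype.card ι * (m * 2 ^ m) := by
    simp [sum_add_distrib]
  have hsum := sum_le_sum hle
  have hiff := sum_eq_sum_iff_of_le hle
  rw [hleft, hright] at hsum hiff
  simp only [mem_univ, true_imp_iff, succ_mul_two_pow_eq_iff] at hiff
  refine ⟨by omega, ?_⟩
  rw [← hiff]
  omega

theorem add_mul_two_pow_le {σ m p : ℕ} (hσ : 0 < σ) (hm : 0 < m) :
    (p + σ) * 2 ^ m ≤ 2 ^ (m * σ + p) := by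
  obtain ⟨s, rfl⟩ : ∃ s, σ = s + 1 := ⟨σ - 1, by omega⟩
  have h1 : p + (s + 1) ≤ 2 ^ (p + s) := Nat.lt_two_pow_self
  have h2 : s ≤ m * s := Nat.le_mul_of_pos_left s hm
  calc (p + (s + 1)) * 2 ^ m ≤ 2 ^ (p + s) * 2 ^ m := Nat.mul_le_mul_right _ h1
    _ = 2 ^ (p + s + m) := (pow_add _ _ _).symm
    _ ≤ 2 ^ (m * (s + 1) + p) := Nat.pow_le_pow_right two_pos (by rw [mul_add]; omega)

/-- The multiset in which every letter has multiplicity `m`, or `m + 1` if it lies in `T`. -/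
def balancedMultiset (m : ℕ) (T : Finset ι) : Multiset ι := m • univ.val + T.val

theorem card_balancedMultiset (m : ℕ) (T : Finset ι) :
    (balancedMultiset m T).card = m * Fintype.card ι + #T := by
  simp [balancedMultiset]

variable [LinearOrder ι]

theorem count_balancedMultiset (m : ℕ) (T : Finset ι) (c : ι) :
    (balancedMultiset m T).count c = m + if c ∈ T then 1 else 0 := by
  rw [balancedMultiset, Multiset.count_add, Multiset.count_nsmul,
    Multiset.count_eq_one_of_mem univ.nodup (mem_univ c), Multiset.count_eq_of_nodup T.nodup]
  simp

theorem sum_count_eq_length (w : List ι) : ∑ c, w.count c = w.length := by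
  simpa using Multiset.sum_count_eq_card (s := univ) (m := (w : Multiset ι)) (by simp)

theorem card_sorted_balanced (m p : ℕ) :
    Nat.card {w : List ι // w.length = m * Fintype.card ι + p ∧ w.Pairwise (· ≤ ·) ∧
      ∀ c, w.count c = m ∨ w.count c = m + 1} = (Fintype.card ι).choose p := by
  have hchoose : Nat.card (powersetCard p (univ : Finset ι)) = (Fintype.card ι).choose p := by
    rw [Nat.card_eq_finsetCard, card_powersetCard, card_univ]
  rw [← hchoose]
  symm
  refine Nat.card_eq_of_bijective (fun T => ⟨(balancedMultiset m T.1).sort (· ≤ ·), ?_, ?_, ?_⟩)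
    ⟨?_, ?_⟩
  · rw [Multiset.length_sort, card_balancedMultiset, (mem_powersetCard.1 T.2).2]
  · exact Multiset.pairwise_sort _ _
  · intro c
    rw [← Multiset.coe_count, Multiset.sort_eq, count_balancedMultiset]
    split_ifs <;> simp
  · rintro ⟨T, hT⟩ ⟨U, hU⟩ h
    have hsort := congrArg (fun l : List ι => (l : Multiset ι)) (Subtype.ext_iff.1 h)
    simp only [Multiset.sort_eq] at hsort
    rw [Subtype.mk.injEq]
    exact Finset.val_injective (add_left_cancel hsort)
  · rintro ⟨w, hlen, hw, hc⟩
    set T : Finset ι := {c | w.count c = m + 1} with hTdef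
    have hT : balancedMultiset m T = (w : Multiset ι) := by
      ext c
      rw [count_balancedMultiset, Multiset.coe_count]
      rcases hc c with h | h <;> simp [hTdef, h]
    have hcard : #T = p := by
      have := card_balancedMultiset m T
      rw [hT, Multiset.coe_card, hlen] at this
      omega
    refine ⟨⟨T, mem_powersetCard.2 ⟨subset_univ _, hcard⟩⟩, Subtype.ext ?_⟩
    refine List.Perm.eq_of_pairwise' (Multiset.pairwise_sort _ _) hw ?_
    rw [← Multiset.coe_eq_coe, Multiset.sort_eq, hT]

end Balanced

theorem totalLyndonSubseq_eq_iff {α : Type*} [LinearOrder α] [Fintype α] [Nonempty α]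
    {m p : ℕ} (hm : 0 < m) {w : List α} (hw : w.length = m * Fintype.card α + p) :
    totalLyndonSubseq w =
        2 ^ w.length - (p + Fintype.card α) * 2 ^ m + w.length + Fintype.card α - 1 ↔
      w.Pairwise (· ≤ ·) ∧ ∀ c, w.count c = m ∨ w.count c = m + 1 := by
  have hσ : 0 < Fintype.card α := Fintype.card_pos
  obtain ⟨hge, hiff⟩ := sum_two_pow_ge_and_eq_iff ((sum_count_eq_length w).trans hw)
  have hbound : (p + Fintype.card α) * 2 ^ m ≤ 2 ^ w.length := hw ▸ add_mul_two_pow_le hσ hm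
  have htotal := totalLyndonSubseq_add_card_nonLyndonSets w
  have hmono := card_monochromaticSets w
  have hnontriv := card_nontrivialMonochromaticSets_add_length w
  have hsub := nontrivialMonochromaticSets_subset w
  have hcard := card_le_card hsub
  have heq : #(nontrivialMonochromaticSets w) = #(nonLyndonSets w) ↔ w.Pairwise (· ≤ ·) := by
    rw [← nonLyndonSets_eq_iff]
    exact ⟨fun h => eq_of_subset_of_card_le hsub h.ge, fun h => h ▸ rfl⟩
  rw [← heq, ← hiff]
  omega

theorem number_of_maximizing_strings (σ n m p : ℕ) (hσ : 0 < σ) (hσn : σ < n)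
    (hn : n = m * σ + p) (hp : p < σ) :
    Nat.card {w : List (Fin σ) //
        w.length = n ∧ totalLyndonSubseq w = 2 ^ n - (p + σ) * 2 ^ m + n + σ - 1}
      = σ.choose p := by
  have hm : 0 < m := by
    rw [Nat.pos_iff_ne_zero]
    rintro rfl
    omega
  have : Nonempty (Fin σ) := ⟨⟨0, hσ⟩⟩
  have hcount := card_sorted_balanced (ι := Fin σ) m p
  simp only [Fintype.card_fin] at hcount
  rw [← hcount]
  refine Nat.card_congr (Equiv.subtypeEquivRight fun w => ?_)
  rw [hn]
  refine and_congr_right fun hw => ?_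
  have := totalLyndonSubseq_eq_iff hm (hw.trans (by rw [Fintype.card_fin]))
  rwa [Fintype.card_fin, hw] at this
end

section
/- Let w = a₁^{k₁} a₂^{k₂} ⋯ a_σ^{k_σ} be the string of length n = k₁ + ⋯ + k_σ over a totally ordered alphabet a₁ < … < a_σ obtained by concatenating, in increasing alphabetical order, a block of k_i copies of a_i for each i (k_i ≥ 0). Then the total number of Lyndon factors of w (pairs (i,j), 1 ≤ i ≤ j ≤ n, with w[i..j] a Lyndon word) equals C(n+1, 2) − Σ_{i=1}^{σ} C(k_i + 1, 2) + n. -/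
/-- The string a₁^{k₁} a₂^{k₂} ⋯ a_σ^{k_σ} over the alphabet Fin σ. -/
def blockString (σ : ℕ) (k : Fin σ → ℕ) : List (Fin σ) :=
  (List.finRange σ).flatMap fun c => List.replicate (k c) c

/-- The total number of Lyndon factors of `w`: the number of pairs of positions
(0-based `i < j ≤ |w|`) such that the substring `w[i..j)` is a Lyndon word. -/
noncomputable def totalLyndonFactors {α : Type*} [LinearOrder α] (w : List α) : ℕ :=
  Nat.card {q : ℕ × ℕ // q.1 < q.2 ∧ q.2 ≤ w.length ∧ IsLyndon ((w.take q.2).drop q.1)}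

/-- A word in nondecreasing order is a Lyndon word iff it is a single letter or its first
letter is smaller than its last one. -/
theorem isLyndon_iff_of_pairwise_le {α : Type*} [LinearOrder α] {u : List α}
    (hu : u.Pairwise (· ≤ ·)) (h0 : 0 < u.length) :
    IsLyndon u ↔ u.length = 1 ∨ u[0] < u[u.length - 1] := by
  have mono : ∀ i j (hi : i < u.length) (hj : j < u.length), i ≤ j → u[i] ≤ u[j] := by
    intro i j hi hj hij
    rcases hij.eq_or_lt with rfl | hlt
    · exact le_rfl
    · exact List.pairwise_iff_getElem.1 hu i j hi hj hlt
  constructor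
  · rintro ⟨-, h⟩
    by_cases h1 : u.length = 1
    · exact Or.inl h1
    right
    have hlex : u < u.drop (u.length - 1) := h (u.length - 1) (by omega) (by omega)
    rcases List.lt_iff_exists.1 hlex with ⟨-, hlen⟩ | ⟨i, h1, h2, -, hi⟩
    · rw [List.length_drop] at hlen
      omega
    · have : i = 0 := by
        rw [List.length_drop] at h2
        omega
      subst this
      simpa using hi
  · rintro (h1 | hlt)
    · exact ⟨List.ne_nil_of_length_pos h0, fun i hi hi' => by omega⟩
    refine ⟨List.ne_nil_of_length_pos h0, fun i hi hi' => ?_⟩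
    classical
    have hex : ∃ p, ∃ hp : p < u.length, u[0] < u[p] := ⟨_, by omega, hlt⟩
    obtain ⟨hp, hlp⟩ := Nat.find_spec hex
    have hmin : ∀ q (hq : q < u.length), q < Nat.find hex → u[q] = u[0] := fun q hq hqp =>
      le_antisymm (not_lt.1 fun hc => Nat.find_min hex hqp ⟨hq, hc⟩) (mono _ _ _ _ (Nat.zero_le _))
    have hpos : 0 < Nat.find hex := by
      by_contra hc
      have hz : Nat.find hex = 0 := by omega
      simp only [hz, lt_irrefl] at hlp
    generalize Nat.find hex = p at *
    change u < u.drop i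
    refine List.lt_iff_exists.2 (Or.inr ⟨p - i, by omega, ?_, ?_, ?_⟩)
    · rw [List.length_drop]
      omega
    · intro j hj
      rw [List.getElem_drop, hmin j (by omega) (by omega), hmin (i + j) (by omega) (by omega)]
    · rw [List.getElem_drop, hmin (p - i) (by omega) (by omega)]
      exact hlp.trans_le (mono _ _ _ _ (by omega))

/-- The number of weakly increasing pairs in a finite set of a linear order. -/
theorem Finset.card_filter_le_product_self {α : Type*} [LinearOrder α] (s : Finset α) :
    ((s ×ˢ s).filter fun q => q.1 ≤ q.2).card = (s.card + 1).choose 2 := by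
  induction s using Finset.induction_on_max with
  | empty => simp
  | insert a s hs ih =>
    have ha : a ∉ s := fun h => lt_irrefl _ (hs a h)
    have hsplit : ((insert a s ×ˢ insert a s).filter fun q => q.1 ≤ q.2)
        = ((s ×ˢ s).filter fun q => q.1 ≤ q.2) ∪ (insert a s).image fun x => (x, a) := by
      ext ⟨x, y⟩
      simp only [Finset.mem_filter, Finset.mem_product, Finset.mem_insert, Finset.mem_union,
        Finset.mem_image, Prod.mk.injEq]
      constructor
      · rintro ⟨⟨rfl | hx, rfl | hy⟩, hle⟩
        · exact Or.inr ⟨_, Or.inl rfl, rfl, rfl⟩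
        · exact absurd (hs y hy) (not_lt.2 hle)
        · exact Or.inr ⟨_, Or.inr hx, rfl, rfl⟩
        · exact Or.inl ⟨⟨hx, hy⟩, hle⟩
      · rintro (⟨⟨hx, hy⟩, hle⟩ | ⟨z, rfl | hz, rfl, rfl⟩)
        · exact ⟨⟨Or.inr hx, Or.inr hy⟩, hle⟩
        · exact ⟨⟨Or.inl rfl, Or.inl rfl⟩, le_rfl⟩
        · exact ⟨⟨Or.inr hz, Or.inl rfl⟩, (hs z hz).le⟩
    rw [hsplit, Finset.card_union_of_disjoint, ih,
      Finset.card_image_of_injective _ (fun x y h => (Prod.ext_iff.1 h).1),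
      Finset.card_insert_of_notMem ha, Nat.choose_succ_succ' (s.card + 1) 1, Nat.choose_one_right,
      add_comm]
    rw [Finset.disjoint_left]
    rintro ⟨x, y⟩ h1 h2
    simp only [Finset.mem_filter, Finset.mem_product, Finset.mem_image,
      Prod.mk.injEq] at h1 h2
    obtain ⟨z, -, -, rfl⟩ := h2
    exact ha h1.1.2

theorem List.card_filter_get_eq {α : Type*} [DecidableEq α] (w : List α) (c : α) :
    (Finset.univ.filter fun i : Fin w.length => w.get i = c).card = w.count c := by
  have := Fin.card_filter_univ_eq_vector_get_eq_count c (⟨w, rfl⟩ : List.Vector α w.length)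
  simpa [List.Vector.get, eq_comm] using this

/-- The weakly increasing pairs of positions of `w` carrying equal letters, counted letter by
letter. -/
theorem List.card_filter_le_get_eq_get {α : Type*} [Fintype α] [DecidableEq α] (w : List α) :
    (Finset.univ.filter fun q : Fin w.length × Fin w.length =>
      q.1 ≤ q.2 ∧ w.get q.1 = w.get q.2).card = ∑ c, (w.count c + 1).choose 2 := by
  rw [Finset.card_eq_sum_card_fiberwise (f := fun q => w.get q.1) (t := Finset.univ)
    (fun _ _ => Finset.mem_coe.2 (Finset.mem_univ _))]
  refine Finset.sum_congr rfl fun c _ => ?_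
  rw [← List.card_filter_get_eq w c, ← Finset.card_filter_le_product_self]
  congr 1
  ext ⟨i, j⟩
  simp only [Finset.mem_filter, Finset.mem_univ, true_and, Finset.mem_product]
  constructor
  · rintro ⟨⟨hle, he⟩, rfl⟩
    exact ⟨⟨rfl, he.symm⟩, hle⟩
  · rintro ⟨⟨hi, hj⟩, hle⟩
    exact ⟨⟨hle, hi.trans hj.symm⟩, hi⟩

/-- The Lyndon factors of a nondecreasing word correspond to the pairs `i ≤ j` of positions
that coincide or carry different letters. -/
theorem totalLyndonFactors_eq_card_of_pairwise_le {α : Type*} [LinearOrder α] {w : List α}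
    (hw : w.Pairwise (· ≤ ·)) :
    totalLyndonFactors w = (Finset.univ.filter fun q : Fin w.length × Fin w.length =>
      q.1 ≤ q.2 ∧ (q.1 = q.2 ∨ w.get q.1 ≠ w.get q.2)).card := by
  have key : ∀ i j (hij : i ≤ j) (hj : j < w.length),
      IsLyndon ((w.take (j + 1)).drop i) ↔ i = j ∨ w[i] ≠ w[j] := by
    intro i j hij hj
    have hlen : ((w.take (j + 1)).drop i).length = j + 1 - i := by
      rw [List.length_drop, List.length_take]
      omega
    rw [isLyndon_iff_of_pairwise_le ((hw.take).drop) (by omega)]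
    have hle : w[i] ≤ w[j] := by
      rcases hij.eq_or_lt with rfl | hlt
      · exact le_rfl
      · exact List.pairwise_iff_getElem.1 hw i j _ hj hlt
    have hidx : i + (j + 1 - i - 1) = j := by omega
    simp only [hlen, List.getElem_drop, List.getElem_take, Nat.add_zero, hidx]
    rw [hle.lt_iff_ne]
    exact or_congr_left (by omega)
  rw [← Nat.card_eq_finsetCard, totalLyndonFactors]
  have hmem : ∀ p : Fin w.length × Fin w.length,
      p ∈ (Finset.univ.filter fun q : Fin w.length × Fin w.length =>
        q.1 ≤ q.2 ∧ (q.1 = q.2 ∨ w.get q.1 ≠ w.get q.2)) →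
      (p.1 : ℕ) < p.2 + 1 ∧ (p.2 : ℕ) + 1 ≤ w.length ∧
        IsLyndon ((w.take (p.2 + 1)).drop p.1) := by
    rintro ⟨i, j⟩ hp
    simp only [Finset.mem_filter, Finset.mem_univ, true_and] at hp
    exact ⟨Nat.lt_succ_of_le hp.1, j.2, (key i j hp.1 j.2).2 (hp.2.imp_left (congrArg Fin.val))⟩
  refine (Nat.card_eq_of_bijective
    (fun p => ⟨((p.1.1 : ℕ), (p.1.2 : ℕ) + 1), hmem p.1 p.2⟩) ⟨?_, ?_⟩).symm
  · rintro ⟨⟨i, j⟩, hp⟩ ⟨⟨i', j'⟩, hp'⟩ h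
    simp only [Subtype.mk.injEq, Prod.mk.injEq, Nat.add_right_cancel_iff] at h
    exact Subtype.ext (Prod.ext (Fin.ext h.1) (Fin.ext h.2))
  · rintro ⟨⟨i, j⟩, hlt, hle, hL⟩
    obtain ⟨j, rfl⟩ : ∃ m, j = m + 1 := ⟨j - 1, by simp only at hlt; omega⟩
    have hij : i ≤ j := Nat.le_of_lt_succ hlt
    refine ⟨⟨(⟨i, lt_of_le_of_lt hij hle⟩, ⟨j, hle⟩), ?_⟩, rfl⟩
    simp only [Finset.mem_filter, Finset.mem_univ, true_and]
    exact ⟨hij, ((key i j hij hle).1 hL).imp_left Fin.ext⟩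

/-- The number of Lyndon factors of a nondecreasing word in terms of its letter counts. -/
theorem totalLyndonFactors_of_pairwise_le {α : Type*} [LinearOrder α] [Fintype α] {w : List α}
    (hw : w.Pairwise (· ≤ ·)) :
    totalLyndonFactors w
      = (w.length + 1).choose 2 - (∑ c, (w.count c + 1).choose 2) + w.length := by
  have hall : (Finset.univ.filter fun q : Fin w.length × Fin w.length => q.1 ≤ q.2).card
      = (w.length + 1).choose 2 := by
    have h := Finset.card_filter_le_product_self (Finset.univ : Finset (Fin w.length))
    rw [Finset.card_fin, Finset.univ_product_univ] at h
    convert h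
  have hdiag : (Finset.univ.filter fun q : Fin w.length × Fin w.length => q.1 = q.2).card
      = w.length := by
    refine Eq.trans ?_ ((Finset.diag_card Finset.univ).trans (Finset.card_fin w.length))
    congr 1
    ext ⟨i, j⟩
    simp
  have hsplit := Finset.card_filter_add_card_filter_not (s := Finset.univ.filter
    fun q : Fin w.length × Fin w.length => q.1 ≤ q.2) (fun q => w.get q.1 = w.get q.2)
  rw [Finset.filter_filter, Finset.filter_filter, List.card_filter_le_get_eq_get, hall] at hsplit
  rw [totalLyndonFactors_eq_card_of_pairwise_le hw, ← hsplit, Nat.add_sub_cancel_left]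
  refine Eq.trans ?_ (congrArg _ hdiag)
  rw [← Finset.card_union_of_disjoint]
  · congr 1
    ext ⟨i, j⟩
    simp only [Finset.mem_filter, Finset.mem_univ, true_and, Finset.mem_union]
    constructor
    · rintro ⟨hle, he | hne⟩
      · exact Or.inr he
      · exact Or.inl ⟨hle, hne⟩
    · rintro (⟨hle, hne⟩ | rfl)
      · exact ⟨hle, Or.inr hne⟩
      · exact ⟨le_rfl, Or.inl rfl⟩
  · rw [Finset.disjoint_left]
    rintro ⟨i, j⟩ h1 h2
    simp only [Finset.mem_filter, Finset.mem_univ, true_and] at h1 h2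
    exact h1.2 (by rw [h2])

theorem pairwise_le_blockString (σ : ℕ) (k : Fin σ → ℕ) :
    (blockString σ k).Pairwise (· ≤ ·) := by
  rw [blockString, List.pairwise_flatMap]
  refine ⟨fun c _ => List.pairwise_replicate.2 (Or.inr le_rfl), ?_⟩
  refine (List.pairwise_lt_finRange σ).imp fun hab x hx y hy => ?_
  rw [List.eq_of_mem_replicate hx, List.eq_of_mem_replicate hy]
  exact hab.le

theorem count_blockString (σ : ℕ) (k : Fin σ → ℕ) (c : Fin σ) :
    (blockString σ k).count c = k c := by
  rw [blockString, List.count_flatMap, ← List.ofFn_eq_map, List.sum_ofFn]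
  simp [List.count_replicate]

theorem length_blockString (σ : ℕ) (k : Fin σ → ℕ) :
    (blockString σ k).length = ∑ i, k i := by
  rw [blockString, List.length_flatMap, ← List.ofFn_eq_map, List.sum_ofFn]
  simp

theorem lyndon_factors_of_block_string (σ : ℕ) (k : Fin σ → ℕ) :
    totalLyndonFactors (blockString σ k)
      = ((∑ i, k i) + 1).choose 2 - (∑ i, (k i + 1).choose 2) + ∑ i, k i := by
  simpa only [count_blockString, length_blockString] using
    totalLyndonFactors_of_pairwise_le (pairwise_le_blockString σ k)
end
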